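/- Fix α > 0 and λ ∈ (0,1], and let d_α(n) = d_α(p_{n;λ}, q_λ). Then, as n → ∞, d_α(n) · (n+1)!/(α^n λ^{n+1}) → 1; more precisely, (d_α(n) · (n+1)!/(α^n λ^{n+1}) − 1 − αλ/(n+2)) · n → 0 as n → ∞. -/

import Mathlib

open scoped BigOperators ENNReal

/-- A probability mass function on ℕ. -/
def IsPmf (p : ℕ → ℝ) : Prop := (∀ j, 0 ≤ p j) ∧ ∑' j, p j = 1

/-- Total variation distance between two pmfs on ℕ. -/
noncomputable def dtv (p q : ℕ → ℝ) : ℝ := (1 / 2) * ∑' j, |p j - q j|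

/-- Descending factorial (j)_k = j(j-1)⋯(j-k+1), as a real number. -/
noncomputable def descFac (j k : ℕ) : ℝ := ∏ i ∈ Finset.range k, ((j : ℝ) - i)

/-- k-th descending factorial moment of a pmf p. -/
noncomputable def facMoment (k : ℕ) (p : ℕ → ℝ) : ℝ := ∑' j, descFac j k * p j

/-- Factorial moment distance of order α, with values in [0,∞]:
    d_α(p,q) = ∑_{k=1}^∞ (α^{k-1}/k!) |M_k(p) - M_k(q)|. -/
noncomputable def dFM (α : ℝ) (p q : ℕ → ℝ) : ℝ≥0∞ :=
  ∑' k : ℕ, ENNReal.ofReal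
    (α ^ k / (Nat.factorial (k + 1) : ℝ) * |facMoment (k + 1) p - facMoment (k + 1) q|)

/-- The Poisson(λ) pmf. -/
noncomputable def poissonPmf (lam : ℝ) (j : ℕ) : ℝ :=
  Real.exp (-lam) * lam ^ j / (Nat.factorial j : ℝ)

/-- The generalized matching pmf p_{n;λ}. -/
noncomputable def genMatch (n : ℕ) (lam : ℝ) (j : ℕ) : ℝ :=
  if j ≤ n then
    lam ^ j / (Nat.factorial j : ℝ) * ∑ i ∈ Finset.range (n - j + 1), (-lam) ^ i / (Nat.factorial i : ℝ)
  else 0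

lemma exp_eq_tsum_pow_div_factorial (x : ℝ) :
    Real.exp x = ∑' m : ℕ, x ^ m / (Nat.factorial m : ℝ) := by
  rw [Real.exp_eq_exp_ℝ, NormedSpace.exp_eq_tsum_div]

lemma descFac_eq_descFactorial (j k : ℕ) : descFac j k = (j.descFactorial k : ℝ) := by
  rw [descFac, ← descPochhammer_eval_eq_prod_range, descPochhammer_eval_eq_descFactorial]

lemma descFac_add_mul_pow_div_factorial (m k : ℕ) (x : ℝ) :
    descFac (m + k) k * (x ^ (m + k) / (Nat.factorial (m + k) : ℝ))
      = x ^ k * (x ^ m / (Nat.factorial m : ℝ)) := by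
  have h := Nat.factorial_mul_descFactorial (Nat.le_add_left k m)
  rw [Nat.add_sub_cancel] at h
  have h' : (Nat.factorial (m + k) : ℝ)
      = (Nat.factorial m : ℝ) * ((m + k).descFactorial k : ℝ) := by exact_mod_cast h.symm
  have hm : (Nat.factorial m : ℝ) ≠ 0 := by positivity
  have hd : ((m + k).descFactorial k : ℝ) ≠ 0 := by
    intro h0
    rw [h0, mul_zero] at h'
    exact (Nat.factorial_ne_zero (m + k)) (by exact_mod_cast h')
  rw [descFac_eq_descFactorial, h']
  field_simp
  ring

lemma tsum_eq_tsum_add_of_zero {f : ℕ → ℝ} {k : ℕ} (hf : ∀ j < k, f j = 0) :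
    ∑' j, f j = ∑' m, f (m + k) := by
  refine ((add_left_injective k).tsum_eq (f := f) ?_).symm
  intro j hj
  have : k ≤ j := by
    by_contra! h
    exact hj (hf j h)
  exact ⟨j - k, Nat.sub_add_cancel this⟩

lemma facMoment_eq_tsum_add (k : ℕ) (p : ℕ → ℝ) :
    facMoment k p = ∑' m, descFac (m + k) k * p (m + k) := by
  refine tsum_eq_tsum_add_of_zero fun j hj => ?_
  rw [descFac_eq_descFactorial, Nat.descFactorial_of_lt hj, Nat.cast_zero, zero_mul]

lemma facMoment_poissonPmf (k : ℕ) (lam : ℝ) : facMoment k (poissonPmf lam) = lam ^ k := by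
  have h : ∀ m, descFac (m + k) k * poissonPmf lam (m + k)
      = (lam ^ k * Real.exp (-lam)) * (lam ^ m / (Nat.factorial m : ℝ)) := fun m => by
    rw [poissonPmf, mul_div_assoc, mul_left_comm, descFac_add_mul_pow_div_factorial]
    ring
  rw [facMoment_eq_tsum_add, tsum_congr h, tsum_mul_left,
    ← exp_eq_tsum_pow_div_factorial lam, mul_assoc, ← Real.exp_add]
  simp

/-- Truncating the Cauchy product of the series of `exp x` and `exp (-x)` leaves only `1`. -/
lemma sum_range_pow_div_factorial_mul_neg (N : ℕ) (x : ℝ) :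
    ∑ m ∈ Finset.range (N + 1), x ^ m / (Nat.factorial m : ℝ) *
      ∑ i ∈ Finset.range (N - m + 1), (-x) ^ i / (Nat.factorial i : ℝ) = 1 := by
  have h1 : ∀ m ∈ Finset.range (N + 1), x ^ m / (Nat.factorial m : ℝ) *
      ∑ i ∈ Finset.range (N - m + 1), (-x) ^ i / (Nat.factorial i : ℝ)
      = ∑ i ∈ Finset.range (N + 1 - m),
        x ^ m / (Nat.factorial m : ℝ) * ((-x) ^ i / (Nat.factorial i : ℝ)) := fun m hm => by
    rw [Finset.mul_sum, Nat.sub_add_comm (Nat.lt_succ_iff.mp (Finset.mem_range.mp hm))]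
  have h2 : ∀ s, ∑ m ∈ Finset.range (s + 1),
      x ^ m / (Nat.factorial m : ℝ) * ((-x) ^ (s - m) / (Nat.factorial (s - m) : ℝ))
      = 0 ^ s / (Nat.factorial s : ℝ) := fun s => by
    rw [← add_neg_cancel x, add_pow, Finset.sum_div]
    refine Finset.sum_congr rfl fun m hm => ?_
    rw [Nat.cast_choose ℝ (Nat.lt_succ_iff.mp (Finset.mem_range.mp hm))]
    have : (Nat.factorial s : ℝ) ≠ 0 := by positivity
    field_simp
  rw [Finset.sum_congr rfl h1, ← Finset.sum_range_diag_flip (N + 1) fun m i =>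
    x ^ m / (Nat.factorial m : ℝ) * ((-x) ^ i / (Nat.factorial i : ℝ)),
    Finset.sum_congr rfl fun s _ => h2 s, Finset.sum_range_succ']
  simp

lemma facMoment_genMatch_of_le {n k : ℕ} (hk : k ≤ n) (lam : ℝ) :
    facMoment k (genMatch n lam) = lam ^ k := by
  rw [facMoment_eq_tsum_add, tsum_eq_sum (s := Finset.range (n - k + 1)) fun m hm => ?_]
  · rw [← mul_one (lam ^ k), ← sum_range_pow_div_factorial_mul_neg (n - k) lam, Finset.mul_sum]
    refine Finset.sum_congr rfl fun m hm => ?_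
    rw [Finset.mem_range] at hm
    rw [genMatch, if_pos (by omega), ← mul_assoc, descFac_add_mul_pow_div_factorial, mul_assoc,
      show n - (m + k) = n - k - m by omega]
  · rw [Finset.mem_range] at hm
    rw [genMatch, if_neg (by omega), mul_zero]

lemma facMoment_genMatch_of_lt {n k : ℕ} (hk : n < k) (lam : ℝ) :
    facMoment k (genMatch n lam) = 0 := by
  rw [facMoment_eq_tsum_add, ← tsum_zero (α := ℝ) (β := ℕ)]
  exact tsum_congr fun m => by rw [genMatch, if_neg (by omega), mul_zero]

lemma toReal_dFM_genMatch_poissonPmf {α lam : ℝ} (hα : 0 < α) (hlam : 0 < lam) (n : ℕ) :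
    (dFM α (genMatch n lam) (poissonPmf lam)).toReal
        * (Nat.factorial (n + 1) : ℝ) / (α ^ n * lam ^ (n + 1))
      = ∑' m : ℕ, (α * lam) ^ m *
        ((Nat.factorial (n + 1) : ℝ) / (Nat.factorial (n + 1 + m) : ℝ)) := by
  rw [dFM, ENNReal.tsum_toReal_eq fun _ => ENNReal.ofReal_ne_top,
    tsum_eq_tsum_add_of_zero (k := n), ← tsum_mul_right, ← tsum_div_const]
  · refine tsum_congr fun m => ?_
    rw [ENNReal.toReal_ofReal (by positivity), facMoment_genMatch_of_lt (by omega),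
      facMoment_poissonPmf, zero_sub, abs_neg, abs_of_pos (by positivity),
      show m + n + 1 = n + 1 + m by omega]
    field_simp
    ring
  · intro k hk
    rw [facMoment_genMatch_of_le (by omega), facMoment_poissonPmf]
    simp

lemma factorial_div_factorial_add_two_le (n m : ℕ) :
    (Nat.factorial (n + 1) : ℝ) / (Nat.factorial (n + 1 + (m + 2)) : ℝ)
      ≤ 1 / (((n : ℝ) + 2) ^ 2 * (Nat.factorial m : ℝ)) := by
  rw [div_le_div_iff₀ (by positivity) (by positivity), one_mul]
  have h1 : Nat.factorial (n + 3) * Nat.factorial m ≤ Nat.factorial (n + 3 + m) :=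
    Nat.le_of_dvd (Nat.factorial_pos _) (Nat.factorial_mul_factorial_dvd_factorial_add _ _)
  have h2 : (n + 2) ^ 2 * Nat.factorial (n + 1) ≤ Nat.factorial (n + 3) := by
    rw [Nat.factorial_succ (n + 2), Nat.factorial_succ (n + 1), ← mul_assoc]
    exact Nat.mul_le_mul_right _ (by nlinarith)
  have h3 : Nat.factorial (n + 1) * ((n + 2) ^ 2 * Nat.factorial m)
      ≤ Nat.factorial (n + 1 + (m + 2)) := by
    rw [show n + 1 + (m + 2) = n + 3 + m by omega]
    calc _ = (n + 2) ^ 2 * Nat.factorial (n + 1) * Nat.factorial m := by ring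
      _ ≤ _ := (Nat.mul_le_mul_right _ h2).trans h1
  exact_mod_cast h3

/-- Second order remainder estimate for the normalized tail of the exponential series. -/
lemma tsum_pow_mul_factorial_div_sub_mem_Icc {x : ℝ} (hx : 0 < x) (n : ℕ) :
    ∑' m : ℕ, x ^ m * ((Nat.factorial (n + 1) : ℝ) / (Nat.factorial (n + 1 + m) : ℝ))
        - 1 - x / ((n : ℝ) + 2)
      ∈ Set.Icc 0 (x ^ 2 * Real.exp x / ((n : ℝ) + 2) ^ 2) := by
  set f : ℕ → ℝ := fun m =>
    x ^ m * ((Nat.factorial (n + 1) : ℝ) / (Nat.factorial (n + 1 + m) : ℝ)) with hf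
  have hle : ∀ m, f (m + 2)
      ≤ x ^ 2 / ((n : ℝ) + 2) ^ 2 * (x ^ m / (Nat.factorial m : ℝ)) := fun m => by
    calc f (m + 2) ≤ x ^ (m + 2) * (1 / (((n : ℝ) + 2) ^ 2 * (Nat.factorial m : ℝ))) :=
          mul_le_mul_of_nonneg_left (factorial_div_factorial_add_two_le n m) (by positivity)
      _ = _ := by field_simp; ring
  have hg : Summable fun m : ℕ => x ^ 2 / ((n : ℝ) + 2) ^ 2 * (x ^ m / (Nat.factorial m : ℝ)) :=
    (Real.summable_pow_div_factorial x).mul_left _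
  have hs2 : Summable fun m => f (m + 2) :=
    hg.of_nonneg_of_le (fun m => by positivity) hle
  have hs : Summable f := (summable_nat_add_iff 2).mp hs2
  have h0 : f 0 = 1 := by simp [hf, Nat.factorial_ne_zero]
  have h1 : f 1 = x / ((n : ℝ) + 2) := by
    simp only [hf]
    rw [Nat.factorial_succ (n + 1)]
    push_cast
    field_simp
    ring
  have hsplit := hs.sum_add_tsum_nat_add 2
  rw [Finset.sum_range_succ, Finset.sum_range_one, h0, h1] at hsplit
  rw [← hsplit, show ∀ a b c : ℝ, a + b + c - a - b = c by intros; ring]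
  refine ⟨tsum_nonneg fun m => by positivity, (hs2.tsum_le_tsum hle hg).trans_eq ?_⟩
  rw [tsum_mul_left, ← exp_eq_tsum_pow_div_factorial x]
  ring

theorem stmt15 (α : ℝ) (hα : 0 < α) (lam : ℝ) (hlam : 0 < lam ∧ lam ≤ 1) :
    Filter.Tendsto
      (fun n : ℕ => (dFM α (genMatch n lam) (poissonPmf lam)).toReal
        * (Nat.factorial (n + 1) : ℝ) / (α ^ n * lam ^ (n + 1)))
      Filter.atTop (nhds 1) ∧
    Filter.Tendsto
      (fun n : ℕ => ((dFM α (genMatch n lam) (poissonPmf lam)).toReal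
          * (Nat.factorial (n + 1) : ℝ) / (α ^ n * lam ^ (n + 1))
          - 1 - α * lam / ((n : ℝ) + 2)) * (n : ℝ))
      Filter.atTop (nhds 0) := by
  simp only [toReal_dFM_genMatch_poissonPmf hα hlam.1]
  have hx : 0 < α * lam := mul_pos hα hlam.1
  generalize α * lam = x at hx ⊢
  have hR := tsum_pow_mul_factorial_div_sub_mem_Icc hx
  have hlim : ∀ c : ℝ, Filter.Tendsto (fun n : ℕ => c / ((n : ℝ) + 2)) Filter.atTop (nhds 0) :=
    fun c => (Filter.tendsto_atTop_add_const_right _ _ tendsto_natCast_atTop_atTop).const_div_atTop c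
  set S : ℕ → ℝ := fun n =>
    ∑' m : ℕ, x ^ m * ((Nat.factorial (n + 1) : ℝ) / (Nat.factorial (n + 1 + m) : ℝ))
  have hC : 0 ≤ x ^ 2 * Real.exp x := by positivity
  constructor
  · have hR0 : Filter.Tendsto (fun n : ℕ => S n - 1 - x / ((n : ℝ) + 2))
        Filter.atTop (nhds 0) := by
      refine squeeze_zero (fun n => (hR n).1) (fun n => (hR n).2.trans ?_)
        (hlim (x ^ 2 * Real.exp x))
      refine div_le_div_of_nonneg_left hC (by positivity) ?_
      nlinarith [Nat.cast_nonneg (α := ℝ) n]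
    have := (hR0.add (hlim x)).add_const 1
    simpa using this
  · refine squeeze_zero (fun n => mul_nonneg (hR n).1 n.cast_nonneg) (fun n => ?_)
      (hlim (x ^ 2 * Real.exp x))
    refine (mul_le_mul_of_nonneg_right (hR n).2 n.cast_nonneg).trans ?_
    rw [div_mul_eq_mul_div, div_le_div_iff₀ (by positivity) (by positivity), mul_assoc]
    refine mul_le_mul_of_nonneg_left ?_ hC
    nlinarith [Nat.cast_nonneg (α := ℝ) n]
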